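/- arXiv:1408.6794 — 5 statements merged into one kernel-verified Lean document; each statement's English description precedes it below -/
import Mathlib

section
/- For every integer d ≥ 1, the Adams map is a well-defined continuous map a : 𝒯̄̄_d → Δ_d. Precisely: for (r₁,…,r_{d−1}, s) ∈ 𝒯̄̄_d, set r₀ = r_d = 1 and s_j = s − (r₁+⋯+r_{j−1}) for 1 ≤ j ≤ d; whenever 0 ≤ s_j ≤ r_j, the point x ∈ ℝ^{d+1} with coordinates x_k = (1−s_j)·r_k·∏_{i=k+1}^{j−1}(1−r_i) for 0 ≤ k < j, x_j = s_j, and x_k = 0 for j < k ≤ d has nonnegative coordinates summing to 1 (so lies in Δ_d); moreover the formulas for consecutive indices j and j+1 agree on the overlap where s_j = r_j (equivalently s_{j+1} = 0), so these piecewise formulas assemble into a single continuous map a : 𝒯̄̄_d → Δ_d. -/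
/-- `r` extended by the conventions `r₀ = r_d = 1`. -/
noncomputable def rext (d : ℕ) (r : ℕ → ℝ) (i : ℕ) : ℝ :=
  if i = 0 ∨ i = d then 1 else r i

/-- The coordinate `s_j = s - (r₁ + ⋯ + r_{j-1})`. -/
noncomputable def sj (r : ℕ → ℝ) (s : ℝ) (j : ℕ) : ℝ :=
  s - ∑ i ∈ Finset.Ico 1 j, r i

/-- The piecewise formula for the `k`-th coordinate of the Adams map, valid on the region
where `0 ≤ s_j ≤ r_j`. -/
noncomputable def adamsFormula (d : ℕ) (r : ℕ → ℝ) (s : ℝ) (j k : ℕ) : ℝ :=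
  if k < j then (1 - sj r s j) * rext d r k * ∏ i ∈ Finset.Ico (k + 1) j, (1 - r i)
  else if k = j then sj r s j
  else 0

/-- The polytope `𝒯̄̄_d ⊆ [0,1]^{d-1} × ℝ`. -/
def TTbar (d : ℕ) : Set ((ℕ → ℝ) × ℝ) :=
  {p | (∀ i, 1 ≤ i → i < d → p.1 i ∈ Set.Icc (0 : ℝ) 1) ∧
       (∀ i, i = 0 ∨ d ≤ i → p.1 i = 0) ∧
       0 ≤ p.2 ∧ p.2 ≤ (∑ i ∈ Finset.Ico 1 d, p.1 i) + 1}

/-- The standard simplex `Δ_d ⊆ ℝ^{d+1}`. -/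
def stdSimplexD (d : ℕ) : Set (ℕ → ℝ) :=
  {x | (∀ k, 0 ≤ x k) ∧ (∀ k, d < k → x k = 0) ∧ ∑ k ∈ Finset.range (d + 1), x k = 1}

/-- Truncation of `s_i` to the interval `[0, r_i]`, with value `1` at `i = 0`. -/
noncomputable def truncatedWeight (d : ℕ) (r : ℕ → ℝ) (s : ℝ) (i : ℕ) : ℝ :=
  if i = 0 then 1 else max 0 (min (sj r s i) (rext d r i))

/-- A single formula for the Adams map, valid on the whole polytope. -/
noncomputable def adamsGlobal (d : ℕ) (r : ℕ → ℝ) (s : ℝ) (k : ℕ) : ℝ :=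
  if k ≤ d then
    truncatedWeight d r s k * ∏ i ∈ Finset.Ico (k + 1) (d + 1), (1 - truncatedWeight d r s i)
  else 0

theorem sum_mul_prod_one_sub_eq_one {R : Type*} [CommRing R] (u : ℕ → R) (h : u 0 = 1) (n : ℕ) :
    ∑ k ∈ Finset.range (n + 1), u k * ∏ i ∈ Finset.Ico (k + 1) (n + 1), (1 - u i) = 1 := by
  induction n with
  | zero => simp [h]
  | succ n ih =>
    have key : ∑ k ∈ Finset.range (n + 1), u k * ∏ i ∈ Finset.Ico (k + 1) (n + 1 + 1), (1 - u i)
        = (∑ k ∈ Finset.range (n + 1), u k * ∏ i ∈ Finset.Ico (k + 1) (n + 1), (1 - u i))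
          * (1 - u (n + 1)) := by
      rw [Finset.sum_mul]
      refine Finset.sum_congr rfl fun k hk => ?_
      rw [Finset.prod_Ico_succ_top (by have := Finset.mem_range.1 hk; omega), mul_assoc]
    rw [Finset.sum_range_succ, key, ih]
    simp

theorem rext_of_pos_of_lt {d : ℕ} (r : ℕ → ℝ) {i : ℕ} (h0 : 1 ≤ i) (h1 : i < d) :
    rext d r i = r i := by
  rw [rext, if_neg (by omega)]

theorem sj_eq_sj_sub_sum (r : ℕ → ℝ) (s : ℝ) {i j : ℕ} (hi : 1 ≤ i) (hij : i ≤ j) :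
    sj r s j = sj r s i - ∑ l ∈ Finset.Ico i j, r l := by
  rw [sj, sj, ← Finset.sum_Ico_consecutive r hi hij]
  ring

theorem rext_le_one {d : ℕ} {r : ℕ → ℝ} (hr : ∀ i, 1 ≤ i → i < d → r i ∈ Set.Icc (0 : ℝ) 1)
    {i : ℕ} (hi : i ≤ d) : rext d r i ≤ 1 := by
  unfold rext
  split_ifs with h
  · exact le_rfl
  · exact (hr i (by omega) (by omega)).2

theorem truncatedWeight_nonneg (d : ℕ) (r : ℕ → ℝ) (s : ℝ) (i : ℕ) :
    0 ≤ truncatedWeight d r s i := by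
  unfold truncatedWeight
  split_ifs
  · exact zero_le_one
  · exact le_max_left _ _

theorem truncatedWeight_le_one {d : ℕ} {r : ℕ → ℝ}
    (hr : ∀ i, 1 ≤ i → i < d → r i ∈ Set.Icc (0 : ℝ) 1) (s : ℝ) {i : ℕ} (hi : i ≤ d) :
    truncatedWeight d r s i ≤ 1 := by
  unfold truncatedWeight
  split_ifs
  · exact le_rfl
  · exact max_le zero_le_one ((min_le_right _ _).trans (rext_le_one hr hi))

theorem adamsGlobal_mem_stdSimplexD {d : ℕ} {r : ℕ → ℝ}
    (hr : ∀ i, 1 ≤ i → i < d → r i ∈ Set.Icc (0 : ℝ) 1) (s : ℝ) :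
    adamsGlobal d r s ∈ stdSimplexD d := by
  refine ⟨fun k => ?_, fun k hk => if_neg (by omega), ?_⟩
  · unfold adamsGlobal
    split_ifs
    · refine mul_nonneg (truncatedWeight_nonneg d r s k) (Finset.prod_nonneg fun i hi => ?_)
      exact sub_nonneg.2 (truncatedWeight_le_one hr s (by have := Finset.mem_Ico.1 hi; omega))
    · exact le_rfl
  · rw [← sum_mul_prod_one_sub_eq_one (truncatedWeight d r s) (if_pos rfl) d]
    exact Finset.sum_congr rfl fun k hk => if_pos (by have := Finset.mem_range.1 hk; omega)

theorem truncatedWeight_of_lt {d : ℕ} {r : ℕ → ℝ}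
    (hr : ∀ i, 1 ≤ i → i < d → r i ∈ Set.Icc (0 : ℝ) 1) {s : ℝ} {j : ℕ}
    (hjd : j ≤ d) (h0 : 0 ≤ sj r s j) {i : ℕ} (hij : i < j) :
    truncatedWeight d r s i = rext d r i := by
  unfold truncatedWeight
  split_ifs with hi
  · simp [rext, hi]
  · have hi1 : 1 ≤ i := by omega
    have hle : r i ≤ ∑ l ∈ Finset.Ico i j, r l :=
      Finset.single_le_sum (f := r)
        (fun l hl => (hr l (by have := Finset.mem_Ico.1 hl; omega)
          (by have := Finset.mem_Ico.1 hl; omega)).1) (Finset.mem_Ico.2 ⟨le_rfl, hij⟩)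
    have hs := sj_eq_sj_sub_sum r s hi1 hij.le
    rw [rext_of_pos_of_lt r hi1 (by omega), min_eq_right (by linarith),
      max_eq_right (hr i hi1 (by omega)).1]

theorem truncatedWeight_self {d : ℕ} {r : ℕ → ℝ} {s : ℝ} {j : ℕ}
    (hj : 1 ≤ j) (h0 : 0 ≤ sj r s j) (h1 : sj r s j ≤ rext d r j) :
    truncatedWeight d r s j = sj r s j := by
  rw [truncatedWeight, if_neg (by omega), min_eq_left h1, max_eq_right h0]

theorem truncatedWeight_of_gt {d : ℕ} {r : ℕ → ℝ}
    (hr : ∀ i, 1 ≤ i → i < d → r i ∈ Set.Icc (0 : ℝ) 1) {s : ℝ} {j : ℕ}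
    (hj : 1 ≤ j) (h1 : sj r s j ≤ rext d r j) {i : ℕ} (hji : j < i)
    (hid : i ≤ d) : truncatedWeight d r s i = 0 := by
  have hle : r j ≤ ∑ l ∈ Finset.Ico j i, r l :=
    Finset.single_le_sum (f := r)
      (fun l hl => (hr l (by have := Finset.mem_Ico.1 hl; omega)
        (by have := Finset.mem_Ico.1 hl; omega)).1) (Finset.mem_Ico.2 ⟨le_rfl, hji⟩)
  have hs := sj_eq_sj_sub_sum r s hj hji.le
  rw [rext_of_pos_of_lt r hj (by omega)] at h1
  rw [truncatedWeight, if_neg (by omega)]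
  exact max_eq_left ((min_le_left _ _).trans (by linarith))

theorem adamsGlobal_eq_adamsFormula {d : ℕ} {r : ℕ → ℝ}
    (hr : ∀ i, 1 ≤ i → i < d → r i ∈ Set.Icc (0 : ℝ) 1) {s : ℝ} {j : ℕ}
    (hj : 1 ≤ j) (hjd : j ≤ d) (h0 : 0 ≤ sj r s j)
    (h1 : sj r s j ≤ rext d r j) : adamsGlobal d r s = adamsFormula d r s j := by
  have htail : ∏ i ∈ Finset.Ico (j + 1) (d + 1), (1 - truncatedWeight d r s i) = 1 := by
    refine Finset.prod_eq_one fun i hi => ?_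
    have := Finset.mem_Ico.1 hi
    rw [truncatedWeight_of_gt hr hj h1 (by omega) (by omega), sub_zero]
  funext k
  unfold adamsGlobal adamsFormula
  rcases lt_trichotomy k j with hk | rfl | hk
  · have hhead : ∏ i ∈ Finset.Ico (k + 1) j, (1 - truncatedWeight d r s i)
        = ∏ i ∈ Finset.Ico (k + 1) j, (1 - r i) := by
      refine Finset.prod_congr rfl fun i hi => ?_
      have := Finset.mem_Ico.1 hi
      rw [truncatedWeight_of_lt hr hjd h0 (by omega),
        rext_of_pos_of_lt r (by omega) (by omega)]
    rw [if_pos (by omega), if_pos hk, truncatedWeight_of_lt hr hjd h0 hk,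
      ← Finset.prod_Ico_consecutive _ (show k + 1 ≤ j + 1 by omega)
        (show j + 1 ≤ d + 1 by omega), htail,
      Finset.prod_Ico_succ_top (by omega), hhead, truncatedWeight_self hj h0 h1]
    ring
  · rw [if_pos hjd, if_neg (lt_irrefl k), if_pos rfl, htail, mul_one,
      truncatedWeight_self hj h0 h1]
  · rw [if_neg (by omega : ¬ k < j), if_neg (by omega : ¬ k = j)]
    split_ifs with hkd
    · rw [truncatedWeight_of_gt hr hj h1 hk hkd, zero_mul]
    · rfl

theorem adamsFormula_succ {d : ℕ} {r : ℕ → ℝ} {s : ℝ} {j : ℕ} (hj : 1 ≤ j) (hjd : j < d)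
    (h : sj r s j = rext d r j) (k : ℕ) :
    adamsFormula d r s j k = adamsFormula d r s (j + 1) k := by
  have hs : sj r s (j + 1) = 0 := by
    rw [sj_eq_sj_sub_sum r s hj (Nat.le_succ j), h, rext_of_pos_of_lt r hj hjd]
    simp
  unfold adamsFormula
  rcases lt_trichotomy k j with hk | rfl | hk
  · rw [if_pos hk, if_pos (by omega), hs, h, Finset.prod_Ico_succ_top (by omega),
      rext_of_pos_of_lt r hj hjd]
    ring
  · simp [hs, h]
  · rw [if_neg (by omega), if_neg (by omega), if_neg (by omega)]
    split_ifs
    · exact hs.symm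
    · rfl

theorem continuous_truncatedWeight (d i : ℕ) :
    Continuous fun p : (ℕ → ℝ) × ℝ => truncatedWeight d p.1 p.2 i := by
  unfold truncatedWeight sj rext
  split_ifs <;> fun_prop

theorem continuous_adamsGlobal (d : ℕ) :
    Continuous fun p : (ℕ → ℝ) × ℝ => adamsGlobal d p.1 p.2 := by
  refine continuous_pi fun k => ?_
  unfold adamsGlobal
  split_ifs
  · exact (continuous_truncatedWeight d k).mul
      (continuous_finsetProd _ fun i _ => continuous_const.sub (continuous_truncatedWeight d i))
  · exact continuous_const

/-- The Adams map is a well-defined continuous map `a : 𝒯̄̄_d → Δ_d`: on the region where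
`0 ≤ s_j ≤ r_j` the piecewise formula has nonnegative coordinates summing to `1`, the formulas
for consecutive indices agree on the overlap `s_j = r_j`, and the piecewise formulas assemble
into a single continuous map `a : 𝒯̄̄_d → Δ_d`. -/
theorem adams_map_well_defined (d : ℕ) (hd : 1 ≤ d) :
    (∀ r : ℕ → ℝ, (∀ i, 1 ≤ i → i < d → r i ∈ Set.Icc (0 : ℝ) 1) →
      ∀ s : ℝ, 0 ≤ s → s ≤ (∑ i ∈ Finset.Ico 1 d, r i) + 1 →
      ∀ j, 1 ≤ j → j ≤ d → 0 ≤ sj r s j → sj r s j ≤ rext d r j →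
        (∀ k, 0 ≤ adamsFormula d r s j k) ∧
        (∑ k ∈ Finset.range (d + 1), adamsFormula d r s j k = 1) ∧
        adamsFormula d r s j ∈ stdSimplexD d) ∧
    (∀ r : ℕ → ℝ, (∀ i, 1 ≤ i → i < d → r i ∈ Set.Icc (0 : ℝ) 1) →
      ∀ s : ℝ, ∀ j, 1 ≤ j → j < d → sj r s j = rext d r j →
        ∀ k, adamsFormula d r s j k = adamsFormula d r s (j + 1) k) ∧
    (∃ a : TTbar d → {x : ℕ → ℝ // x ∈ stdSimplexD d}, Continuous a ∧
      ∀ p : TTbar d, ∀ j, 1 ≤ j → j ≤ d →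
        0 ≤ sj p.1.1 p.1.2 j → sj p.1.1 p.1.2 j ≤ rext d p.1.1 j →
        ∀ k, (a p).1 k = adamsFormula d p.1.1 p.1.2 j k) := by
  refine ⟨fun r hr s _ _ j hj hjd h0 h1 => ?_, fun r _ s j hj hjd h => adamsFormula_succ hj hjd h,
    fun p => ⟨adamsGlobal d p.1.1 p.1.2, adamsGlobal_mem_stdSimplexD p.2.1 _⟩,
    ((continuous_adamsGlobal d).comp continuous_subtype_val).subtype_mk _,
    fun p j hj hjd h0 h1 k => congrFun (adamsGlobal_eq_adamsFormula p.2.1 hj hjd h0 h1) k⟩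
  have hmem := adamsGlobal_mem_stdSimplexD hr s
  rw [adamsGlobal_eq_adamsFormula hr hj hjd h0 h1] at hmem
  exact ⟨hmem.1, hmem.2.2, hmem⟩
end

section
/- Let K be a finite linearly ordered set with at least two elements, and let I, J be subsets with {min K, max K} ⊆ I ⊆ J ⊆ K. Write I = {j₀ < j₁ < ⋯ < j_m}, so that j₀ = min K and j_m = max K. Then the boundary stratum 𝒜̄_{I⊂J} := {x ∈ [0,1]^{K∖{min K, max K}} : x_i = 1 for all i ∈ I∖{min K, max K}, and x_i = 0 for all i ∈ K∖J} of the compactified Adams moduli space admits a natural product decomposition: the map restricting coordinates is a homeomorphism from 𝒜̄_{I⊂J} onto the product ∏_{k=1}^{m} [0,1]^{{j ∈ J : j_{k−1} < j < j_k}}, i.e. onto the product of the compactified Adams moduli spaces of the intervals of J between consecutive elements of I. -/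
/-- An element outside a finset containing lower and upper bounds of the order lies strictly
between two consecutive elements of that finset. -/
theorem exists_consecutive_of_notMem {K : Type*} [LinearOrder K] {I : Finset K} {m M k : K}
    (hm : m ≤ k) (hM : k ≤ M) (hmI : m ∈ I) (hMI : M ∈ I) (hk : k ∉ I) :
    ∃ p : {p : K × K // p.1 ∈ I ∧ p.2 ∈ I ∧ p.1 < p.2 ∧ ∀ i ∈ I, ¬(p.1 < i ∧ i < p.2)},
      p.1.1 < k ∧ k < p.1.2 := by
  have hmk : m < k := hm.lt_of_ne fun h => hk (h ▸ hmI)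
  have hkM : k < M := hM.lt_of_ne fun h => hk (h ▸ hMI)
  obtain ⟨a, ha, hamax⟩ := (I.filter (· < k)).exists_max_image id
    ⟨m, Finset.mem_filter.2 ⟨hmI, hmk⟩⟩
  obtain ⟨b, hb, hbmin⟩ := (I.filter (k < ·)).exists_min_image id
    ⟨M, Finset.mem_filter.2 ⟨hMI, hkM⟩⟩
  rw [Finset.mem_filter] at ha hb
  refine ⟨⟨(a, b), ha.1, hb.1, ha.2.trans hb.2, fun i hi h => ?_⟩, ha.2, hb.2⟩
  rcases lt_trichotomy i k with hik | rfl | hki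
  · exact (hamax i (Finset.mem_filter.2 ⟨hi, hik⟩)).not_gt h.1
  · exact hk hi
  · exact (hbmin i (Finset.mem_filter.2 ⟨hi, hki⟩)).not_gt h.2

/-- Two consecutive pairs of elements of a finset that enclose a common element are equal. -/
theorem consecutive_pair_unique {K : Type*} [LinearOrder K] {I : Finset K} {k : K}
    {p q : {p : K × K // p.1 ∈ I ∧ p.2 ∈ I ∧ p.1 < p.2 ∧ ∀ i ∈ I, ¬(p.1 < i ∧ i < p.2)}}
    (hp : p.1.1 < k ∧ k < p.1.2) (hq : q.1.1 < k ∧ k < q.1.2) : p = q := by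
  obtain ⟨ha, hb, -, hab⟩ := p.2
  obtain ⟨hc, hd, -, hcd⟩ := q.2
  refine Subtype.ext (Prod.ext (le_antisymm ?_ ?_) (le_antisymm ?_ ?_))
  · exact not_lt.1 fun h => hcd _ ha ⟨h, hp.1.trans hq.2⟩
  · exact not_lt.1 fun h => hab _ hc ⟨h, hq.1.trans hp.2⟩
  · exact not_lt.1 fun h => hab _ hd ⟨hp.1.trans hq.2, h⟩
  · exact not_lt.1 fun h => hcd _ hb ⟨hq.1.trans hp.2, h⟩

/-- The boundary stratum `𝒜̄_{I⊂J}` of the compactified Adams moduli space `𝒜̄_K`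
(coordinates labelled by `I ∖ {min K, max K}` equal to `1`, coordinates labelled by `K ∖ J`
equal to `0`) decomposes as a product: coordinate restriction is a homeomorphism onto the
product, over consecutive pairs of elements of `I`, of the cubes on the sets of elements of
`J` strictly between the members of the pair. -/
theorem adams_boundary_stratum_product (K : Type) [Fintype K] [LinearOrder K]
    (hcard : 2 ≤ Fintype.card K)
    (m M : K) (hm : ∀ k, m ≤ k) (hM : ∀ k, k ≤ M)
    (I J : Finset K) (hIJ : I ⊆ J) (hmI : m ∈ I) (hMI : M ∈ I)
    (A : Set ({k : K // k ≠ m ∧ k ≠ M} → ℝ))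
    (hA : A = {x | (∀ k, x k ∈ Set.Icc (0 : ℝ) 1) ∧ (∀ k, k.1 ∈ I → x k = 1) ∧
               (∀ k, k.1 ∉ J → x k = 0)}) :
    ∃ e : ↥A ≃ₜ
        ↥{y : (p : {p : K × K // p.1 ∈ I ∧ p.2 ∈ I ∧ p.1 < p.2 ∧
                ∀ i ∈ I, ¬(p.1 < i ∧ i < p.2)}) →
              ({j : K // j ∈ J ∧ p.1.1 < j ∧ j < p.1.2} → ℝ) |
            ∀ p j, y p j ∈ Set.Icc (0 : ℝ) 1},
      ∀ x p j, (e x).1 p j =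
        x.1 ⟨j.1, ((hm p.1.1).trans_lt j.2.2.1).ne', (j.2.2.2.trans_le (hM p.1.2)).ne⟩ := by
  subst hA
  choose g hg using fun (k : K) (hk : k ∉ I) =>
    exists_consecutive_of_notMem (hm k) (hM k) hmI hMI hk
  refine ⟨{
    toFun := fun x => ⟨fun p j => x.1 ⟨j.1, ((hm p.1.1).trans_lt j.2.2.1).ne',
      (j.2.2.2.trans_le (hM p.1.2)).ne⟩, fun p j => x.2.1 _⟩
    invFun := fun y => ⟨fun k => if hI : k.1 ∈ I then 1 else
      if hJ : k.1 ∈ J then y.1 (g k.1 hI) ⟨k.1, hJ, hg k.1 hI⟩ else 0, ?_, ?_, ?_⟩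
    left_inv := ?_
    right_inv := ?_
    continuous_toFun := ?_
    continuous_invFun := ?_ }, fun x p j => rfl⟩
  · intro k
    dsimp only
    split_ifs with hI hJ
    · simp
    · exact y.2 _ _
    · simp
  · intro k hk
    exact dif_pos hk
  · intro k hk
    dsimp only
    rw [dif_neg fun h => hk (hIJ h), dif_neg hk]
  · intro x
    refine Subtype.ext (funext fun k => ?_)
    dsimp only
    split_ifs with hI hJ
    · exact (x.2.2.1 k hI).symm
    · rfl
    · exact (x.2.2.2 k hJ).symm
  · intro y
    refine Subtype.ext (funext fun p => funext fun j => ?_)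
    obtain ⟨j, hJ, hj⟩ := j
    have hI : j ∉ I := fun h => p.2.2.2.2 j h hj
    dsimp only
    rw [dif_neg hI, dif_pos hJ]
    obtain rfl := consecutive_pair_unique hj (hg j hI)
    rfl
  · refine Continuous.subtype_mk (continuous_pi fun p => continuous_pi fun j => ?_) _
    exact (continuous_apply _).comp continuous_subtype_val
  · refine Continuous.subtype_mk (continuous_pi fun k => ?_) _
    split_ifs with hI hJ
    · exact continuous_const
    · exact (continuous_apply _).comp ((continuous_apply (g k.1 hI)).comp continuous_subtype_val)
    · exact continuous_const
end

section
/- Let K₋ and K₊ be finite nonempty linearly ordered sets, and let 𝒜̄_{K₋,K₊} be the associated prism Adams moduli space, a cube whose coordinates are indexed by (K₊×{+} ⊔ K₋×{−}) ∖ {(min K₊,+), (max K₋,−)}. Then the boundary of this cube (the set of points having some coordinate equal to 0 or 1) is exactly the union of the following four families of codimension-1 faces, each of which is canonically homeomorphic, via the evident coordinate bijection, to the indicated space: (1) for i ∈ K₋∖{max K₋}, the face where the coordinate (i,−) equals 0 is homeomorphic to 𝒜̄_{K₋∖{i}, K₊}; (2) for i ∈ K₊∖{min K₊}, the face where the coordinate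 (i,+) equals 0 is homeomorphic to 𝒜̄_{K₋, K₊∖{i}}; (3) for i ∈ K₋∖{max K₋}, the face where the coordinate (i,−) equals 1 is homeomorphic to 𝒜̄_{K₋^{≥i}} × 𝒜̄_{K₋^{≤i}, K₊}, where K₋^{≥i} = {j ∈ K₋ : j ≥ i} and K₋^{≤i} = {j ∈ K₋ : j ≤ i}; (4) for i ∈ K₊∖{min K₊}, the face where the coordinate (i,+) equals 1 is homeomorphic to 𝒜̄_{K₋, K₊^{≥i}} × 𝒜̄_{K₊^{≤i}}. -/
theorem exists_homeomorph_cube_face {S T : Type*} {f : S → T} (hf : f.Injective) {t₀ : T}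
    (hrange : Set.range f = {t₀}ᶜ) {c : ℝ} (hc : c ∈ Set.Icc (0 : ℝ) 1) :
    ∃ e : ↥{x ∈ {x : T → ℝ | ∀ t, x t ∈ Set.Icc (0 : ℝ) 1} | x t₀ = c} ≃ₜ
        ↥{y : S → ℝ | ∀ s, y s ∈ Set.Icc (0 : ℝ) 1},
      ∀ x s, (e x).1 s = x.1 (f s) := by
  have h₀ : ¬ ∃ s, f s = t₀ := by
    rw [← Set.mem_range, hrange]
    simp
  have hcover (t : T) (ht : t ≠ t₀) : ∃ s, f s = t := by
    rwa [← Set.mem_range, hrange]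
  refine ⟨{
    toFun := fun x => ⟨fun s => x.1 (f s), fun s => x.2.1 (f s)⟩
    invFun := fun y => ⟨Function.extend f y.1 fun _ => c, fun t => ?_,
      Function.extend_apply' _ _ _ h₀⟩
    left_inv := fun x => ?_
    right_inv := fun y => ?_
    continuous_toFun := ?_
    continuous_invFun := ?_ }, fun _ _ => rfl⟩
  · by_cases ht : t = t₀
    · rw [ht, Function.extend_apply' _ _ _ h₀]
      exact hc
    · obtain ⟨s, rfl⟩ := hcover t ht
      rw [hf.extend_apply]
      exact y.2 s
  · ext t
    by_cases ht : t = t₀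
    · rw [ht, x.2.2]
      exact Function.extend_apply' (fun s => x.1 (f s)) (fun _ => c) _ h₀
    · obtain ⟨s, rfl⟩ := hcover t ht
      exact hf.extend_apply (fun s => x.1 (f s)) (fun _ => c) s
  · ext s
    exact hf.extend_apply y.1 (fun _ => c) s
  · refine Continuous.subtype_mk (continuous_pi fun s => ?_) _
    exact (continuous_apply (f s)).comp continuous_subtype_val
  · refine Continuous.subtype_mk (continuous_pi fun t => ?_) _
    by_cases ht : t = t₀
    · simp only [ht, Function.extend_apply' _ _ _ h₀]
      exact continuous_const
    · obtain ⟨s, rfl⟩ := hcover t ht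
      simp only [hf.extend_apply]
      exact (continuous_apply s).comp continuous_subtype_val

theorem exists_homeomorph_cube_face_prod {A B T : Type*} {f : A ⊕ B → T} (hf : f.Injective)
    {t₀ : T} (hrange : Set.range f = {t₀}ᶜ) {c : ℝ} (hc : c ∈ Set.Icc (0 : ℝ) 1) :
    ∃ e : ↥{x ∈ {x : T → ℝ | ∀ t, x t ∈ Set.Icc (0 : ℝ) 1} | x t₀ = c} ≃ₜ
        ↥{z : (A → ℝ) × (B → ℝ) |
          (∀ a, z.1 a ∈ Set.Icc (0 : ℝ) 1) ∧ (∀ b, z.2 b ∈ Set.Icc (0 : ℝ) 1)},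
      (∀ x a, (e x).1.1 a = x.1 (f (Sum.inl a))) ∧
        ∀ x b, (e x).1.2 b = x.1 (f (Sum.inr b)) := by
  obtain ⟨e, he⟩ := exists_homeomorph_cube_face hf hrange hc
  exact ⟨e.trans (Homeomorph.sumArrowHomeomorphProdArrow.subtype fun _ => Sum.forall),
    fun x a => he x (Sum.inl a), fun x b => he x (Sum.inr b)⟩


/-- The boundary of the prism Adams moduli space `𝒜̄_{K₋,K₊}`, the cube with coordinates
indexed by `(K₊ ⊔ K₋) ∖ {min K₊, max K₋}` (`K₊` being the `+` part and `K₋` the `−` part),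
is exactly the union of four families of codimension-1 faces, and each face is canonically
homeomorphic, via the evident coordinate bijection, to: (1) `𝒜̄_{K₋∖{i},K₊}` for the face
`(i,−) = 0`; (2) `𝒜̄_{K₋,K₊∖{i}}` for the face `(i,+) = 0`; (3) `𝒜̄_{K₋^{≥i}} × 𝒜̄_{K₋^{≤i},K₊}`
for the face `(i,−) = 1`; (4) `𝒜̄_{K₋,K₊^{≥i}} × 𝒜̄_{K₊^{≤i}}` for the face `(i,+) = 1`. -/
theorem prism_adams_boundary_faces (Km Kp : Type) [Fintype Km] [LinearOrder Km]
    [Fintype Kp] [LinearOrder Kp] [Nonempty Km] [Nonempty Kp]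
    (p0 : Kp) (hp0 : ∀ k, p0 ≤ k) (m1 : Km) (hm1 : ∀ k, k ≤ m1)
    (C : Set ({t : Kp ⊕ Km // t ≠ Sum.inl p0 ∧ t ≠ Sum.inr m1} → ℝ))
    (hC : C = {x | ∀ t, x t ∈ Set.Icc (0 : ℝ) 1}) :
    -- the boundary is exactly the union of the four families of faces
    ({x ∈ C | ∃ t, x t = 0 ∨ x t = 1} =
      ((⋃ (i : Km) (hi : i ≠ m1),
          {x ∈ C | x ⟨Sum.inr i, Sum.inr_ne_inl, fun h => hi (Sum.inr.inj h)⟩ = 0}) ∪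
       (⋃ (i : Kp) (hi : i ≠ p0),
          {x ∈ C | x ⟨Sum.inl i, fun h => hi (Sum.inl.inj h), Sum.inl_ne_inr⟩ = 0}) ∪
       (⋃ (i : Km) (hi : i ≠ m1),
          {x ∈ C | x ⟨Sum.inr i, Sum.inr_ne_inl, fun h => hi (Sum.inr.inj h)⟩ = 1}) ∪
       (⋃ (i : Kp) (hi : i ≠ p0),
          {x ∈ C | x ⟨Sum.inl i, fun h => hi (Sum.inl.inj h), Sum.inl_ne_inr⟩ = 1}))) ∧
    -- (1) the face `(i,−) = 0` is the cube `𝒜̄_{K₋∖{i},K₊}`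
    (∀ (i : Km) (hi : i ≠ m1),
      ∃ e : ↥{x ∈ C | x ⟨Sum.inr i, Sum.inr_ne_inl, fun h => hi (Sum.inr.inj h)⟩ = 0} ≃ₜ
          ↥{y : {t : Kp ⊕ Km // t ≠ Sum.inl p0 ∧ t ≠ Sum.inr m1 ∧ t ≠ Sum.inr i} → ℝ |
              ∀ t, y t ∈ Set.Icc (0 : ℝ) 1},
        ∀ x t, (e x).1 t = x.1 ⟨t.1, t.2.1, t.2.2.1⟩) ∧
    -- (2) the face `(i,+) = 0` is the cube `𝒜̄_{K₋,K₊∖{i}}`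
    (∀ (i : Kp) (hi : i ≠ p0),
      ∃ e : ↥{x ∈ C | x ⟨Sum.inl i, fun h => hi (Sum.inl.inj h), Sum.inl_ne_inr⟩ = 0} ≃ₜ
          ↥{y : {t : Kp ⊕ Km // t ≠ Sum.inl p0 ∧ t ≠ Sum.inr m1 ∧ t ≠ Sum.inl i} → ℝ |
              ∀ t, y t ∈ Set.Icc (0 : ℝ) 1},
        ∀ x t, (e x).1 t = x.1 ⟨t.1, t.2.1, t.2.2.1⟩) ∧
    -- (3) the face `(i,−) = 1` is `𝒜̄_{K₋^{≥i}} × 𝒜̄_{K₋^{≤i},K₊}`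
    (∀ (i : Km) (hi : i ≠ m1),
      ∃ e : ↥{x ∈ C | x ⟨Sum.inr i, Sum.inr_ne_inl, fun h => hi (Sum.inr.inj h)⟩ = 1} ≃ₜ
          ↥{z : ({j : Km // i < j ∧ j < m1} → ℝ) ×
                (({k : Kp // k ≠ p0} ⊕ {j : Km // j < i}) → ℝ) |
              (∀ j, z.1 j ∈ Set.Icc (0 : ℝ) 1) ∧ (∀ t, z.2 t ∈ Set.Icc (0 : ℝ) 1)},
        (∀ x (j : {j : Km // i < j ∧ j < m1}),
          (e x).1.1 j = x.1 ⟨Sum.inr j.1, Sum.inr_ne_inl, fun h => j.2.2.ne (Sum.inr.inj h)⟩) ∧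
        (∀ x (k : {k : Kp // k ≠ p0}),
          (e x).1.2 (Sum.inl k) =
            x.1 ⟨Sum.inl k.1, fun h => k.2 (Sum.inl.inj h), Sum.inl_ne_inr⟩) ∧
        (∀ x (j : {j : Km // j < i}),
          (e x).1.2 (Sum.inr j) =
            x.1 ⟨Sum.inr j.1, Sum.inr_ne_inl,
              fun h => (j.2.trans_le (hm1 i)).ne (Sum.inr.inj h)⟩)) ∧
    -- (4) the face `(i,+) = 1` is `𝒜̄_{K₋,K₊^{≥i}} × 𝒜̄_{K₊^{≤i}}`
    (∀ (i : Kp) (hi : i ≠ p0),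
      ∃ e : ↥{x ∈ C | x ⟨Sum.inl i, fun h => hi (Sum.inl.inj h), Sum.inl_ne_inr⟩ = 1} ≃ₜ
          ↥{z : (({k : Kp // i < k} ⊕ {j : Km // j ≠ m1}) → ℝ) ×
                ({k : Kp // p0 < k ∧ k < i} → ℝ) |
              (∀ t, z.1 t ∈ Set.Icc (0 : ℝ) 1) ∧ (∀ k, z.2 k ∈ Set.Icc (0 : ℝ) 1)},
        (∀ x (k : {k : Kp // i < k}),
          (e x).1.1 (Sum.inl k) =
            x.1 ⟨Sum.inl k.1, fun h => ((hp0 i).trans_lt k.2).ne' (Sum.inl.inj h),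
              Sum.inl_ne_inr⟩) ∧
        (∀ x (j : {j : Km // j ≠ m1}),
          (e x).1.1 (Sum.inr j) =
            x.1 ⟨Sum.inr j.1, Sum.inr_ne_inl, fun h => j.2 (Sum.inr.inj h)⟩) ∧
        (∀ x (k : {k : Kp // p0 < k ∧ k < i}),
          (e x).1.2 k =
            x.1 ⟨Sum.inl k.1, fun h => k.2.1.ne' (Sum.inl.inj h), Sum.inl_ne_inr⟩)) := by
  subst hC
  have zero_mem : (0 : ℝ) ∈ Set.Icc (0 : ℝ) 1 := by simp
  have one_mem : (1 : ℝ) ∈ Set.Icc (0 : ℝ) 1 := by simp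
  refine ⟨?_, fun i hi => ?_, fun i hi => ?_, fun i hi => ?_, fun i hi => ?_⟩
  · ext x
    simp only [Set.mem_union, Set.mem_iUnion, Set.mem_sep_iff]
    constructor
    · rintro ⟨hx, ⟨k | k, h₁, h₂⟩, h | h⟩
      · exact .inl (.inl (.inr ⟨k, fun h => h₁ (congrArg _ h), hx, h⟩))
      · exact .inr ⟨k, fun h => h₁ (congrArg _ h), hx, h⟩
      · exact .inl (.inl (.inl ⟨k, fun h => h₂ (congrArg _ h), hx, h⟩))
      · exact .inl (.inr ⟨k, fun h => h₂ (congrArg _ h), hx, h⟩)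
    · rintro (((⟨_, _, hx, h⟩ | ⟨_, _, hx, h⟩) | ⟨_, _, hx, h⟩) | ⟨_, _, hx, h⟩)
      exacts [⟨hx, _, .inl h⟩, ⟨hx, _, .inl h⟩, ⟨hx, _, .inr h⟩, ⟨hx, _, .inr h⟩]
  · let f (t : {t : Kp ⊕ Km // t ≠ Sum.inl p0 ∧ t ≠ Sum.inr m1 ∧ t ≠ Sum.inr i}) :
        {t : Kp ⊕ Km // t ≠ Sum.inl p0 ∧ t ≠ Sum.inr m1} := ⟨t.1, t.2.1, t.2.2.1⟩
    refine exists_homeomorph_cube_face (f := f)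
      (fun s t h => Subtype.ext (Subtype.mk.inj h)) ?_ zero_mem
    ext ⟨t, h₁, h₂⟩
    simp [f, h₁, h₂]
  · let f (t : {t : Kp ⊕ Km // t ≠ Sum.inl p0 ∧ t ≠ Sum.inr m1 ∧ t ≠ Sum.inl i}) :
        {t : Kp ⊕ Km // t ≠ Sum.inl p0 ∧ t ≠ Sum.inr m1} := ⟨t.1, t.2.1, t.2.2.1⟩
    refine exists_homeomorph_cube_face (f := f)
      (fun s t h => Subtype.ext (Subtype.mk.inj h)) ?_ zero_mem
    ext ⟨t, h₁, h₂⟩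
    simp [f, h₁, h₂]
  · let f : {j : Km // i < j ∧ j < m1} ⊕ ({k : Kp // k ≠ p0} ⊕ {j : Km // j < i}) →
        {t : Kp ⊕ Km // t ≠ Sum.inl p0 ∧ t ≠ Sum.inr m1} :=
      Sum.elim (fun j => ⟨Sum.inr j.1, Sum.inr_ne_inl, fun h => j.2.2.ne (Sum.inr.inj h)⟩)
        (Sum.elim (fun k => ⟨Sum.inl k.1, fun h => k.2 (Sum.inl.inj h), Sum.inl_ne_inr⟩)
          fun j => ⟨Sum.inr j.1, Sum.inr_ne_inl,
            fun h => (j.2.trans_le (hm1 i)).ne (Sum.inr.inj h)⟩)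
    have hf : f.Injective := by
      rintro (⟨a, ha⟩ | ⟨a, ha⟩ | ⟨a, ha⟩) (⟨b, hb⟩ | ⟨b, hb⟩ | ⟨b, hb⟩) h <;>
        simp [f] at h ⊢ <;> grind
    obtain ⟨e, h₁, h₂⟩ := exists_homeomorph_cube_face_prod hf
      (t₀ := ⟨Sum.inr i, Sum.inr_ne_inl, fun h => hi (Sum.inr.inj h)⟩) (by
        ext ⟨k | k, hk₁, hk₂⟩
        · simpa [f] using hk₁
        · have := (hm1 k).lt_of_ne fun h => hk₂ (congrArg _ h)
          simp [f]
          grind) one_mem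
    exact ⟨e, h₁, fun x k => h₂ x (Sum.inl k), fun x j => h₂ x (Sum.inr j)⟩
  · let f : ({k : Kp // i < k} ⊕ {j : Km // j ≠ m1}) ⊕ {k : Kp // p0 < k ∧ k < i} →
        {t : Kp ⊕ Km // t ≠ Sum.inl p0 ∧ t ≠ Sum.inr m1} :=
      Sum.elim (Sum.elim
          (fun k => ⟨Sum.inl k.1, fun h => ((hp0 i).trans_lt k.2).ne' (Sum.inl.inj h),
            Sum.inl_ne_inr⟩)
          fun j => ⟨Sum.inr j.1, Sum.inr_ne_inl, fun h => j.2 (Sum.inr.inj h)⟩)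
        fun k => ⟨Sum.inl k.1, fun h => k.2.1.ne' (Sum.inl.inj h), Sum.inl_ne_inr⟩
    have hf : f.Injective := by
      rintro ((⟨a, ha⟩ | ⟨a, ha⟩) | ⟨a, ha⟩) ((⟨b, hb⟩ | ⟨b, hb⟩) | ⟨b, hb⟩) h <;>
        simp [f] at h ⊢ <;> grind
    obtain ⟨e, h₁, h₂⟩ := exists_homeomorph_cube_face_prod hf
      (t₀ := ⟨Sum.inl i, fun h => hi (Sum.inl.inj h), Sum.inl_ne_inr⟩) (by
        ext ⟨k | k, hk₁, hk₂⟩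
        · have := (hp0 k).lt_of_ne fun h => hk₁ (congrArg _ h.symm)
          simp [f]
          grind
        · simpa [f] using hk₂) one_mem
    exact ⟨e, fun x k => h₁ x (Sum.inl k), fun x j => h₁ x (Sum.inr j), h₂⟩
end

section
/- Let n ≥ 1, let P ⊆ ℝⁿ be nonempty, and let g, h : ℤⁿ → ℝ both converge at every point of P. Then for every A ∈ ℤⁿ the infimum f(A) := inf_{B ∈ ℤⁿ} ( g(B) + h(A−B) ) is a real number and is attained (the infimum is over a set bounded below, with only finitely many B realizing values below any given bound), and the resulting function f : ℤⁿ → ℝ again converges at every point of P. -/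
/-- `g : ℤⁿ → ℝ` converges at `v ∈ ℝⁿ` if for every `M` the set
`{A : g(A) + ⟨v,A⟩ ≤ M}` is finite (i.e. `g(A) + ⟨v,A⟩ → +∞`). -/
def ConvergesAt (n : ℕ) (g : (Fin n → ℤ) → ℝ) (v : Fin n → ℝ) : Prop :=
  ∀ M : ℝ, {A : Fin n → ℤ | g A + ∑ i, v i * (A i : ℝ) ≤ M}.Finite

theorem exists_forall_le_of_finite_sublevel {α : Type*} [Nonempty α] {u : α → ℝ}
    (hu : ∀ M : ℝ, {a | u a ≤ M}.Finite) : ∃ a₀, ∀ a, u a₀ ≤ u a := by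
  obtain ⟨a⟩ := ‹Nonempty α›
  obtain ⟨a₀, ha₀, hmin⟩ := Set.exists_min_image _ u (hu (u a)) ⟨a, le_refl (u a)⟩
  refine ⟨a₀, fun b => ?_⟩
  rcases le_total (u b) (u a) with hb | hb
  · exact hmin b hb
  · exact (show u a₀ ≤ u a from ha₀).trans hb

theorem finite_sublevel_add_prod {α β : Type*} [Nonempty α] [Nonempty β] {u : α → ℝ} {w : β → ℝ}
    (hu : ∀ M : ℝ, {a | u a ≤ M}.Finite) (hw : ∀ M : ℝ, {b | w b ≤ M}.Finite) (M : ℝ) :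
    {p : α × β | u p.1 + w p.2 ≤ M}.Finite := by
  obtain ⟨a₀, ha₀⟩ := exists_forall_le_of_finite_sublevel hu
  obtain ⟨b₀, hb₀⟩ := exists_forall_le_of_finite_sublevel hw
  refine ((hu (M - w b₀)).prod (hw (M - u a₀))).subset ?_
  rintro ⟨a, b⟩ hab
  have hab' : u a + w b ≤ M := hab
  have ha := ha₀ a
  have hb := hb₀ b
  constructor
  · show u a ≤ M - w b₀
    linarith
  · show w b ≤ M - u a₀
    linarith

theorem sum_mul_intCast_add_sum_mul_intCast_sub {n : ℕ} (v : Fin n → ℝ) (A B : Fin n → ℤ) :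
    ∑ i, v i * (B i : ℝ) + ∑ i, v i * ((A - B) i : ℝ) = ∑ i, v i * (A i : ℝ) := by
  rw [← Finset.sum_add_distrib]
  refine Finset.sum_congr rfl fun i _ => ?_
  rw [Pi.sub_apply]
  push_cast
  ring

theorem ConvergesAt.finite_add_sub {n : ℕ} {g h : (Fin n → ℤ) → ℝ} {v : Fin n → ℝ}
    (hg : ConvergesAt n g v) (hh : ConvergesAt n h v) (A : Fin n → ℤ) (M : ℝ) :
    {B : Fin n → ℤ | g B + h (A - B) ≤ M}.Finite := by
  have hfin := finite_sublevel_add_prod hg hh (M + ∑ i, v i * (A i : ℝ))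
  have hinj : Function.Injective fun B : Fin n → ℤ => (B, A - B) :=
    fun _ _ hBC => congrArg Prod.fst hBC
  refine (hfin.preimage hinj.injOn).subset fun B hB => ?_
  have hB' : g B + h (A - B) ≤ M := hB
  have hsum := sum_mul_intCast_add_sum_mul_intCast_sub v A B
  show g B + ∑ i, v i * (B i : ℝ) + (h (A - B) + ∑ i, v i * ((A - B) i : ℝ)) ≤ _
  linarith

theorem ConvergesAt.exists_isLeast_add_sub {n : ℕ} {g h : (Fin n → ℤ) → ℝ} {v : Fin n → ℝ}
    (hg : ConvergesAt n g v) (hh : ConvergesAt n h v) (A : Fin n → ℤ) :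
    ∃ B₀ : Fin n → ℤ,
      IsLeast (Set.range fun B : Fin n → ℤ => g B + h (A - B)) (g B₀ + h (A - B₀)) := by
  obtain ⟨B₀, hB₀⟩ := exists_forall_le_of_finite_sublevel (hg.finite_add_sub hh A)
  exact ⟨B₀, ⟨B₀, rfl⟩, Set.forall_mem_range.2 hB₀⟩

theorem ConvergesAt.infConvolution {n : ℕ} {g h : (Fin n → ℤ) → ℝ} {v : Fin n → ℝ}
    (hg : ConvergesAt n g v) (hh : ConvergesAt n h v) :
    ConvergesAt n (fun A => sInf (Set.range fun B : Fin n → ℤ => g B + h (A - B))) v := by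
  intro M
  refine ((finite_sublevel_add_prod hg hh M).image fun p => p.1 + p.2).subset fun A hA => ?_
  obtain ⟨B, hB⟩ := hg.exists_isLeast_add_sub hh A
  have hA' : sInf (Set.range fun B : Fin n → ℤ => g B + h (A - B)) +
      ∑ i, v i * (A i : ℝ) ≤ M := hA
  rw [hB.csInf_eq] at hA'
  have hsum := sum_mul_intCast_add_sum_mul_intCast_sub v A B
  refine ⟨(B, A - B), ?_, add_sub_cancel B A⟩
  show g B + ∑ i, v i * (B i : ℝ) + (h (A - B) + ∑ i, v i * ((A - B) i : ℝ)) ≤ M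
  linarith

/-- If `g, h : ℤⁿ → ℝ` both converge at every point of a nonempty set `P ⊆ ℝⁿ`, then for every
`A` the infimum `f(A) = inf_B (g(B) + h(A−B))` is a real number and is attained (the infimum is
over a set bounded below, with only finitely many `B` realizing values below any given bound),
and the resulting function `f` again converges at every point of `P`. -/
theorem infConvolution_convergesAt (n : ℕ) (hn : 1 ≤ n)
    (P : Set (Fin n → ℝ)) (hP : P.Nonempty)
    (g h : (Fin n → ℤ) → ℝ)
    (hg : ∀ v ∈ P, ConvergesAt n g v) (hh : ∀ v ∈ P, ConvergesAt n h v) :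
    (∀ (A : Fin n → ℤ) (M : ℝ), {B : Fin n → ℤ | g B + h (A - B) ≤ M}.Finite) ∧
    (∀ A : Fin n → ℤ, BddBelow (Set.range fun B : Fin n → ℤ => g B + h (A - B))) ∧
    (∀ A : Fin n → ℤ, ∃ B₀ : Fin n → ℤ,
      IsLeast (Set.range fun B : Fin n → ℤ => g B + h (A - B)) (g B₀ + h (A - B₀))) ∧
    (∀ v ∈ P, ConvergesAt n
      (fun A => sInf (Set.range fun B : Fin n → ℤ => g B + h (A - B))) v) := by
  obtain ⟨v, hv⟩ := hP
  have hleast := (hg v hv).exists_isLeast_add_sub (hh v hv)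
  exact ⟨(hg v hv).finite_add_sub (hh v hv),
    fun A => (hleast A).elim fun _ hB => ⟨_, hB.2⟩, hleast,
    fun w hw => (hg w hw).infConvolution (hh w hw)⟩
end

section
/- Let n ≥ 1, let (q_i) be points of ℝⁿ indexed by a linearly ordered set, and let f_{ij} : ℝⁿ → ℝ be functions, for i < j, such that for every triple i < j < k the function c_{ijk} := f_{ij} + f_{jk} − f_{ik} is affine with constant differential dc_{ijk} ∈ ℤⁿ (i.e. c_{ijk}(v) = c_{ijk}(w) + ⟨dc_{ijk}, v − w⟩ for all v, w). Then for every quadruple i < j < k < l: (a) c_{jkl} − c_{ikl} + c_{ijl} − c_{ijk} = 0 identically, and dc_{jkl} − dc_{ikl} + dc_{ijl} − dc_{ijk} = 0 in ℤⁿ; (b) the exponent identity c_{jkl}(q_l) − c_{ikl}(q_l) + c_{ijl}(q_l) − c_{ijk}(q_k) − ⟨dc_{ijk}, q_l − q_k⟩ = 0 holds. Identity (b) is the Čech cocycle identity α_{jkl} · α_{ikl}^{−1} · α_{ijl} · α_{ijk}^{−1} = 1 for the twisting monomials α_{ijk} = T^{c_{ijk}(q_k)} z_{q_k}^{dc_{ijk}},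 after rewriting all monomials in the common basepoint q_l via the relation z_q^A = T^{⟨q′ − q, A⟩} z_{q′}^A. -/
/-- Given points `q_i ∈ ℝⁿ` and functions `f_{ij} : ℝⁿ → ℝ` (for `i < j` in a linearly ordered
index set) such that each `c_{ijk} = f_{ij} + f_{jk} − f_{ik}` is affine with constant integral
differential `dc_{ijk} ∈ ℤⁿ`, one has, for every `i < j < k < l`:
(a) `c_{jkl} − c_{ikl} + c_{ijl} − c_{ijk} = 0` identically and
`dc_{jkl} − dc_{ikl} + dc_{ijl} − dc_{ijk} = 0`; and
(b) the exponent identity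
`c_{jkl}(q_l) − c_{ikl}(q_l) + c_{ijl}(q_l) − c_{ijk}(q_k) − ⟨dc_{ijk}, q_l − q_k⟩ = 0`,
which is the Čech cocycle identity for the twisting monomials
`α_{ijk} = T^{c_{ijk}(q_k)} z_{q_k}^{dc_{ijk}}`. -/
theorem twisting_cocycle_identity (n : ℕ) (hn : 1 ≤ n) (ι : Type) [LinearOrder ι]
    (q : ι → Fin n → ℝ) (f : ι → ι → (Fin n → ℝ) → ℝ)
    (dc : ι → ι → ι → (Fin n → ℤ))
    (hc : ∀ i j k : ι, i < j → j < k → ∀ v w : Fin n → ℝ,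
      f i j v + f j k v - f i k v =
        (f i j w + f j k w - f i k w) + ∑ m, (dc i j k m : ℝ) * (v m - w m)) :
    ∀ i j k l : ι, i < j → j < k → k < l →
      (∀ v : Fin n → ℝ,
        (f j k v + f k l v - f j l v) - (f i k v + f k l v - f i l v) +
          (f i j v + f j l v - f i l v) - (f i j v + f j k v - f i k v) = 0) ∧
      (dc j k l - dc i k l + dc i j l - dc i j k = 0) ∧
      ((f j k (q l) + f k l (q l) - f j l (q l)) -
          (f i k (q l) + f k l (q l) - f i l (q l)) +
          (f i j (q l) + f j l (q l) - f i l (q l)) -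
          (f i j (q k) + f j k (q k) - f i k (q k)) -
          ∑ m, (dc i j k m : ℝ) * (q l m - q k m) = 0) := by
  intro i j k l hij hjk hkl
  refine ⟨fun v => by ring, ?_, ?_⟩
  · ext m
    have h₁ := hc j k l hjk hkl (Pi.single m 1) 0
    have h₂ := hc i k l (hij.trans hjk) hkl (Pi.single m 1) 0
    have h₃ := hc i j l hij (hjk.trans hkl) (Pi.single m 1) 0
    have h₄ := hc i j k hij hjk (Pi.single m 1) 0
    simp only [Pi.zero_apply, sub_zero, Pi.single_apply, mul_ite, mul_one, mul_zero,
      Finset.sum_ite_eq', Finset.mem_univ, if_true] at h₁ h₂ h₃ h₄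
    have h : (dc j k l m : ℝ) - dc i k l m + dc i j l m - dc i j k m = 0 := by linarith
    exact_mod_cast h
  · linarith [hc i j k hij hjk (q l) (q k)]
end
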